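/- arXiv:2211.14076 — 3 statements merged into one kernel-verified Lean document; each statement's English description precedes it below -/
import Mathlib

section
/- If a language L over a finite alphabet A is C-balanced for length n, then for every k < n it is balanced for length k; more precisely, L is ((#A)^{n-k}·C + n − 1)-balanced for length k. -/
open List

/-- Number of occurrences of `v` as a factor of `w`, i.e. the number of
decompositions `w = p ++ v ++ s`. -/
def occ {A : Type*} [DecidableEq A] (v w : List A) : ℕ :=
  (List.range (w.length + 1)).countP (fun i => decide (v <+: w.drop i))

/-- Apply a substitution (given by its values on letters) to a word. -/
def applyS {A B : Type*} (σ : A → List B) (w : List A) : List B :=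
  (w.map σ).flatten

theorem occ_nil {A : Type*} [DecidableEq A] (v : List A) :
    occ v [] = if v = [] then 1 else 0 := by
  simp [occ, List.range_succ, List.countP_cons]

theorem occ_cons {A : Type*} [DecidableEq A] (v : List A) (a : A) (w : List A) :
    occ v (a :: w) = (if v <+: a :: w then 1 else 0) + occ v w := by
  unfold occ
  rw [List.length_cons, List.range_succ_eq_map, List.countP_cons, List.countP_map, add_comm]
  simp [Function.comp_def]

theorem occ_empty {A : Type*} [DecidableEq A] (w : List A) : occ [] w = w.length + 1 := by
  induction w with
  | nil => simp [occ_nil]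
  | cons a w ih => rw [occ_cons, ih]; simp; omega

/-- A prefix `v` of `w` extends in exactly one way to a prefix of length `v.length + m`,
provided `w` is long enough. -/
theorem sum_append_isPrefix {A : Type*} [Fintype A] [DecidableEq A] (v w : List A) (m : ℕ) :
    ∑ u : List.Vector A m, (if v ++ u.toList <+: w then 1 else 0) =
      if v <+: w ∧ v.length + m ≤ w.length then 1 else 0 := by
  split_ifs with h
  · obtain ⟨⟨t, rfl⟩, hlen⟩ := h
    have ht : (t.take m).length = m := by
      simp only [List.length_append] at hlen
      simp; omega
    obtain ⟨x, hx⟩ : ∃ x : List.Vector A m, x.toList = t.take m := ⟨⟨_, ht⟩, rfl⟩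
    refine (Fintype.sum_eq_single x fun u hu => if_neg fun hp => hu ?_).trans ?_
    · have := List.prefix_iff_eq_take.1 ((List.prefix_append_right_inj v).1 hp)
      rw [List.Vector.toList_length, ← hx] at this
      exact Subtype.ext this
    · simp [hx, List.take_prefix]
  · refine Finset.sum_eq_zero fun u _ => if_neg fun hp => h ⟨?_, ?_⟩
    · exact (List.prefix_append _ _).trans hp
    · simpa using hp.length_le

/-- Occurrences of `v` that do not extend by `m` letters start close to the end of the word. -/
theorem occ_eq_sum_add {A : Type*} [Fintype A] [DecidableEq A] (v w : List A) (m : ℕ)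
    (hm : 0 < m) :
    ∃ e : ℕ, e ≤ m ∧ e ≤ w.length + 1 - v.length ∧
      occ v w = ∑ u : List.Vector A m, occ (v ++ u.toList) w + e := by
  induction w with
  | nil =>
    have hne (u : List.Vector A m) : v ++ u.toList ≠ [] := by
      intro h
      have := congrArg List.length h
      simp at this
      omega
    refine ⟨occ v [], ?_, ?_, ?_⟩
    · rw [occ_nil]; split_ifs <;> omega
    · rw [occ_nil]; split_ifs with h <;> simp [h]
    · simp [occ_nil v, occ_nil (v ++ _), hne]
  | cons a w ih =>
    obtain ⟨e, he, he', ih⟩ := ih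
    simp only [occ_cons, Finset.sum_add_distrib, sum_append_isPrefix, ih]
    by_cases hp : v <+: a :: w
    · have hl := hp.length_le
      by_cases hlen : v.length + m ≤ (a :: w).length
      · refine ⟨e, he, ?_, ?_⟩
        · simp only [List.length_cons]; omega
        · simp only [hp, hlen, and_self, if_true]; omega
      · simp only [List.length_cons] at hl hlen ⊢
        refine ⟨e + 1, by omega, by omega, ?_⟩
        simp only [hp, hlen, and_false, if_true, if_false]; omega
    · refine ⟨e, he, ?_, ?_⟩
      · simp only [List.length_cons]; omega
      · simp only [hp, false_and, if_false]; omega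

/-- If a language `L` over a finite alphabet `A` is `C`-balanced for
length `n`, then for every `k < n` it is `((#A)^(n-k) * C + n - 1)`-balanced for
length `k`. -/
theorem balanced_of_balanced_longer {A : Type*} [Fintype A] [DecidableEq A]
    (L : Set (List A)) (C n k : ℕ) (hk : k < n)
    (hbal : ∀ v : List A, v.length = n → ∀ w ∈ L, ∀ w' ∈ L,
      w.length = w'.length → |(occ v w : ℤ) - (occ v w' : ℤ)| ≤ (C : ℤ)) :
    ∀ v : List A, v.length = k → ∀ w ∈ L, ∀ w' ∈ L,
      w.length = w'.length →
      |(occ v w : ℤ) - (occ v w' : ℤ)| ≤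
        (Fintype.card A : ℤ) ^ (n - k) * (C : ℤ) + (n : ℤ) - 1 := by
  intro v hv w hw w' hw' hlen
  have hpow : (0 : ℤ) ≤ (Fintype.card A : ℤ) ^ (n - k) * (C : ℤ) := by positivity
  rcases Nat.eq_zero_or_pos k with rfl | hk0
  · obtain rfl := List.length_eq_zero_iff.1 hv
    rw [occ_empty, occ_empty, hlen, sub_self, abs_zero]
    omega
  obtain ⟨e, he, -, h⟩ := occ_eq_sum_add v w (n - k) (by omega)
  obtain ⟨e', he', -, h'⟩ := occ_eq_sum_add v w' (n - k) (by omega)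
  have hsum : |∑ u : List.Vector A (n - k),
      ((occ (v ++ u.toList) w : ℤ) - (occ (v ++ u.toList) w' : ℤ))| ≤
        (Fintype.card A : ℤ) ^ (n - k) * (C : ℤ) := by
    refine (Finset.abs_sum_le_sum_abs _ _).trans ?_
    refine (Finset.sum_le_card_nsmul _ _ (C : ℤ) fun u _ => ?_).trans ?_
    · exact hbal _ (by simp [hv]; omega) w hw w' hw' hlen
    · simp [card_vector]
  rw [Finset.sum_sub_distrib] at hsum
  rw [h, h']
  push_cast
  rw [abs_le] at hsum ⊢
  constructor <;> omega
end

section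
/- Let L be an infinite, factorial language over a finite alphabet A that is letter-C-balanced. Then there exists a vector (f_a)_{a∈A} of nonnegative reals such that | |w|_a − f_a·|w| | ≤ C for every letter a ∈ A and every word w ∈ L. -/
open List

theorem occ_singleton {A : Type*} [DecidableEq A] (a : A) (w : List A) :
    occ [a] w = w.count a := by
  induction w with
  | nil => simp [occ]
  | cons x w ih =>
    rw [occ, List.length_cons, List.range_succ_eq_map, List.countP_cons, List.countP_map]
    have h : (List.range (w.length + 1)).countP
        ((fun i => decide ([a] <+: (x :: w).drop i)) ∘ Nat.succ) = w.count a := by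
      rw [← ih, occ]
      rfl
    rw [h, List.count_cons]
    by_cases hx : a = x <;> simp [hx, Ne.symm]

/-- An infinite factorial language over a finite alphabet has words of every length. -/
theorem exists_mem_length_eq {A : Type*} [Finite A] {L : Set (List A)} (hinf : L.Infinite)
    (hfac : ∀ w ∈ L, ∀ v : List A, v <:+: w → v ∈ L) (n : ℕ) :
    ∃ w ∈ L, w.length = n := by
  obtain ⟨w, hw, hn⟩ : ∃ w ∈ L, n ≤ w.length := by
    by_contra! h
    exact hinf ((List.finite_length_lt A n).subset h)
  exact ⟨w.take n, hfac w hw _ (List.take_prefix n w).isInfix, by simp [hn]⟩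

/-- A lower bound on the number of occurrences of a letter in the factors of length `n`
gives a lower bound for words of length `k * n`. -/
theorem mul_le_count {A : Type*} [DecidableEq A] {L : Set (List A)}
    (hfac : ∀ w ∈ L, ∀ v : List A, v <:+: w → v ∈ L) (a : A) (n : ℕ) (m : ℤ)
    (hm : ∀ w ∈ L, w.length = n → m ≤ w.count a) (k : ℕ) :
    ∀ w ∈ L, w.length = k * n → k * m ≤ w.count a := by
  induction k with
  | zero => simp
  | succ k ih =>
    intro w hw hlen
    rw [Nat.succ_mul] at hlen
    have h₁ := hm (w.take n) (hfac w hw _ (List.take_prefix n w).isInfix) (by simp; omega)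
    have h₂ := ih (w.drop n) (hfac w hw _ (List.drop_suffix n w).isInfix) (by simp; omega)
    have h₃ : w.count a = (w.take n).count a + (w.drop n).count a := by
      rw [← List.count_append, List.take_append_drop]
    rw [h₃]
    push_cast
    linarith

/-- An upper bound on the number of occurrences of a letter in the factors of length `n`
gives an upper bound for words of length `k * n`. -/
theorem count_le_mul {A : Type*} [DecidableEq A] {L : Set (List A)}
    (hfac : ∀ w ∈ L, ∀ v : List A, v <:+: w → v ∈ L) (a : A) (n : ℕ) (m : ℤ)
    (hm : ∀ w ∈ L, w.length = n → w.count a ≤ m) (k : ℕ) :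
    ∀ w ∈ L, w.length = k * n → w.count a ≤ k * m := by
  induction k with
  | zero => simp +contextual
  | succ k ih =>
    intro w hw hlen
    rw [Nat.succ_mul] at hlen
    have h₁ := hm (w.take n) (hfac w hw _ (List.take_prefix n w).isInfix) (by simp; omega)
    have h₂ := ih (w.drop n) (hfac w hw _ (List.drop_suffix n w).isInfix) (by simp; omega)
    have h₃ : w.count a = (w.take n).count a + (w.drop n).count a := by
      rw [← List.count_append, List.take_append_drop]
    rw [h₃]
    push_cast
    linarith

/-- In a balanced language, the lower frequency bound given by any word is at most the upper
frequency bound given by any other word. -/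
theorem length_mul_count_sub_le {A : Type*} [Finite A] [DecidableEq A]
    {L : Set (List A)} {C : ℕ} (hinf : L.Infinite)
    (hfac : ∀ w ∈ L, ∀ v : List A, v <:+: w → v ∈ L) (a : A)
    (hbal : ∀ w ∈ L, ∀ w' ∈ L, w.length = w'.length →
      |(w.count a : ℤ) - (w'.count a : ℤ)| ≤ (C : ℤ))
    {u v : List A} (hu : u ∈ L) (hv : v ∈ L) :
    (v.length : ℤ) * (u.count a - C) ≤ u.length * (v.count a + C) := by
  obtain ⟨w, hw, hlen⟩ := exists_mem_length_eq hinf hfac (v.length * u.length)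
  refine (mul_le_count hfac a u.length (u.count a - C) ?_ v.length w hw hlen).trans
    (count_le_mul hfac a v.length (v.count a + C) ?_ u.length w hw (by rw [hlen, mul_comm]))
  · intro x hx h
    linarith [(abs_le.mp (hbal x hx u hu h)).1]
  · intro x hx h
    linarith [(abs_le.mp (hbal x hx v hv h)).2]

/-- an infinite, factorial, letter-`C`-balanced language over a finite
alphabet admits a vector of nonnegative letter frequencies `f` with
`||w|_a - f_a * |w|| ≤ C` for all letters `a` and words `w ∈ L`. -/
theorem exists_frequency_vector {A : Type*} [Fintype A] [DecidableEq A]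
    (L : Set (List A)) (C : ℕ)
    (hinf : L.Infinite)
    (hfac : ∀ w ∈ L, ∀ v : List A, v <:+: w → v ∈ L)
    (hbal : ∀ a : A, ∀ w ∈ L, ∀ w' ∈ L, w.length = w'.length →
      |(occ [a] w : ℤ) - (occ [a] w' : ℤ)| ≤ (C : ℤ)) :
    ∃ f : A → ℝ, (∀ a : A, 0 ≤ f a) ∧
      ∀ a : A, ∀ w ∈ L, |(occ [a] w : ℝ) - f a * (w.length : ℝ)| ≤ (C : ℝ) := by
  simp only [occ_singleton] at hbal ⊢
  have hle (a : A) {u v : List A} (hu : u ∈ L) (hv : v ∈ L) (hv0 : 0 < v.length) :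
      ((u.count a : ℝ) - C) / u.length ≤ ((v.count a : ℝ) + C) / v.length := by
    have h : (v.length : ℝ) * (u.count a - C) ≤ u.length * (v.count a + C) := by
      exact_mod_cast length_mul_count_sub_le hinf hfac a (hbal a) hu hv
    rcases Nat.eq_zero_or_pos u.length with h0 | h0
    · rw [h0, Nat.cast_zero, div_zero]
      positivity
    · rw [div_le_div_iff₀ (by exact_mod_cast h0) (by exact_mod_cast hv0)]
      linarith
  have hbdd (a : A) :
      BddAbove ((fun u : List A => ((u.count a : ℝ) - C) / u.length) '' L) := by
    obtain ⟨v, hv, hv1⟩ := exists_mem_length_eq hinf hfac 1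
    refine ⟨((v.count a : ℝ) + C) / v.length, ?_⟩
    rintro _ ⟨u, hu, rfl⟩
    exact hle a hu hv (by omega)
  obtain ⟨w₀, hw₀⟩ := hinf.nonempty
  refine ⟨fun a => sSup ((fun u : List A => ((u.count a : ℝ) - C) / u.length) '' L),
    fun a => ?_, fun a w hw => ?_⟩
  · exact le_csSup (hbdd a) ⟨[], hfac w₀ hw₀ [] (List.nil_infix), by simp⟩
  · rcases Nat.eq_zero_or_pos w.length with h0 | h0
    · rw [List.length_eq_zero_iff] at h0
      simp [h0]
    · have hpos : (0 : ℝ) < w.length := by exact_mod_cast h0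
      have h₁ := le_csSup (hbdd a) ⟨w, hw, rfl⟩
      have h₂ : sSup ((fun u : List A => ((u.count a : ℝ) - C) / u.length) '' L) ≤
          ((w.count a : ℝ) + C) / w.length := by
        refine csSup_le ⟨_, w₀, hw₀, rfl⟩ ?_
        rintro _ ⟨u, hu, rfl⟩
        exact hle a hu hw h0
      rw [div_le_iff₀ hpos] at h₁
      rw [le_div_iff₀ hpos] at h₂
      rw [abs_le]
      constructor <;> linarith
end

section
/- Let L ⊆ A* be a letter-C-balanced factorial language and σ: A* → B* a substitution. Then for all w, w' ∈ F(σ(L)) with |w| = |w'|, there exist words x, x', z, z' ∈ B* and y, y' ∈ L such that w = x σ(y) z, w' = x' σ(y') z', |y| = |y'|, and max{|x z|, |x' z'|} ≤ (2 + C·#A)·‖σ‖ − 2. -/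
open List

theorem length_applyS {A B : Type*} [Fintype A] [DecidableEq A] (σ : A → List B) (y : List A) :
    (applyS σ y).length = ∑ a, y.count a * (σ a).length := by
  induction y with
  | nil => simp [applyS]
  | cons b y ih =>
    simp only [applyS, List.map_cons, List.flatten_cons, List.length_append] at ih ⊢
    simp [ih, List.count_cons, add_mul, Finset.sum_add_distrib, add_comm]

theorem applyS_append {A B : Type*} (σ : A → List B) (u v : List A) :
    applyS σ (u ++ v) = applyS σ u ++ applyS σ v := by
  simp [applyS]

theorem exists_of_prefix_applyS {A B : Type*} {σ : A → List B} {M : ℕ}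
    (hM : ∀ a, (σ a).length ≤ M) (Y : List A) (w : List B) (h : w <+: applyS σ Y) :
    ∃ y z, y <+: Y ∧ w = applyS σ y ++ z ∧ z.length ≤ M - 1 := by
  induction Y generalizing w with
  | nil => exact ⟨[], [], by simp, by simpa [applyS] using h, by simp⟩
  | cons a Y ih =>
    obtain ⟨s, hs⟩ := h
    have hs' : w ++ s = σ a ++ applyS σ Y := by simpa [applyS] using hs
    rcases List.append_eq_append_iff.1 hs' with ⟨c, hc, -⟩ | ⟨w₁, hw₁, hr⟩
    · rcases c with _ | ⟨b, c⟩
      · exact ⟨[a], [], by simp, by simpa [applyS] using hc.symm, by simp⟩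
      · refine ⟨[], w, by simp, by simp [applyS], ?_⟩
        have := hM a
        rw [hc, List.length_append, List.length_cons] at this
        lia
    · obtain ⟨y, z, hy, rfl, hz⟩ := ih w₁ ⟨s, hr.symm⟩
      exact ⟨a :: y, z, by simpa using hy, by simpa [applyS] using hw₁, hz⟩

theorem exists_of_infix_applyS {A B : Type*} {σ : A → List B} {M : ℕ}
    (hM : ∀ a, (σ a).length ≤ M) (Y : List A) (w : List B) (h : w <:+: applyS σ Y) :
    ∃ x y z, y <:+: Y ∧ w = x ++ applyS σ y ++ z ∧ x.length ≤ M - 1 ∧ z.length ≤ M - 1 := by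
  induction Y with
  | nil => exact ⟨[], [], [], List.infix_refl _, by simpa [applyS] using h, by simp, by simp⟩
  | cons a Y ih =>
    obtain ⟨p, s, hs⟩ := h
    have hs' : p ++ (w ++ s) = σ a ++ applyS σ Y := by simpa [applyS] using hs
    rcases List.append_eq_append_iff.1 hs' with ⟨c, hc, hws⟩ | ⟨p', -, hr⟩
    · rcases p with _ | ⟨b, p⟩
      · obtain ⟨y, z, hy, hw, hz⟩ := exists_of_prefix_applyS hM (a :: Y) w ⟨s, by simpa using hs⟩
        exact ⟨[], y, z, hy.isInfix, by simpa using hw, by simp, hz⟩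
      · have hcM : c.length ≤ M - 1 := by
          have := hM a
          rw [hc, List.length_append, List.length_cons] at this
          lia
        rcases List.append_eq_append_iff.1 hws with ⟨c', hc', -⟩ | ⟨w₁, hw₁, hr⟩
        · refine ⟨w, [], [], List.nil_infix, by simp [applyS], ?_, by simp⟩
          rw [hc', List.length_append] at hcM
          lia
        · obtain ⟨y, z, hy, rfl, hz⟩ := exists_of_prefix_applyS hM Y w₁ ⟨s, hr.symm⟩
          exact ⟨c, y, z, List.infix_cons hy.isInfix, by simpa using hw₁, hcM, hz⟩
    · obtain ⟨x, y, z, hy, h⟩ := ih ⟨p', s, by simpa using hr.symm⟩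
      exact ⟨x, y, z, List.infix_cons hy, h⟩

theorem length_applyS_le_add {A B : Type*} [Fintype A] [DecidableEq A] {σ : A → List B} {M C : ℕ}
    (hM : ∀ a, (σ a).length ≤ M) {y y' : List A} (h : ∀ a, y.count a ≤ y'.count a + C) :
    (applyS σ y).length ≤ (applyS σ y').length + C * Fintype.card A * M := by
  rw [length_applyS, length_applyS]
  calc ∑ a, y.count a * (σ a).length
      ≤ ∑ a, (y'.count a * (σ a).length + C * M) := Finset.sum_le_sum fun a _ => by
        calc y.count a * (σ a).length ≤ (y'.count a + C) * (σ a).length :=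
              Nat.mul_le_mul_right _ (h a)
          _ ≤ y'.count a * (σ a).length + C * M := by
              rw [add_mul]
              exact Nat.add_le_add_left (Nat.mul_le_mul_left _ (hM a)) _
    _ = _ := by
        rw [Finset.sum_add_distrib, Finset.sum_const, Finset.card_univ, smul_eq_mul]
        ring

/-- decomposition of two equal-length factors of `σ(L)` for a
letter-`C`-balanced factorial language `L`. -/
theorem factor_decomposition {A B : Type*} [Fintype A] [DecidableEq A] [DecidableEq B]
    (L : Set (List A)) (C : ℕ) (σ : A → List B)
    (hfac : ∀ w ∈ L, ∀ v : List A, v <:+: w → v ∈ L)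
    (hbal : ∀ a : A, ∀ w ∈ L, ∀ w' ∈ L, w.length = w'.length →
      |(occ [a] w : ℤ) - (occ [a] w' : ℤ)| ≤ (C : ℤ))
    (w w' : List B)
    (hw : ∃ y ∈ L, w <:+: applyS σ y) (hw' : ∃ y ∈ L, w' <:+: applyS σ y)
    (hlen : w.length = w'.length) :
    ∃ (x z x' z' : List B) (y y' : List A), y ∈ L ∧ y' ∈ L ∧
      w = x ++ applyS σ y ++ z ∧ w' = x' ++ applyS σ y' ++ z' ∧
      y.length = y'.length ∧
      max (x.length + z.length) (x'.length + z'.length) ≤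
        (2 + C * Fintype.card A) * (Finset.univ.sup fun a : A => (σ a).length) - 2 := by
  set M := Finset.univ.sup fun a : A => (σ a).length
  have hM : ∀ a, (σ a).length ≤ M := fun a =>
    Finset.le_sup (f := fun a : A => (σ a).length) (Finset.mem_univ a)
  obtain ⟨Y, hY, hwY⟩ := hw
  obtain ⟨Y', hY', hwY'⟩ := hw'
  obtain ⟨x, y, z, hy, hwy, hx, hz⟩ := exists_of_infix_applyS hM Y w hwY
  obtain ⟨x', y', z', hy', hwy', hx', hz'⟩ := exists_of_infix_applyS hM Y' w' hwY'
  replace hy := hfac Y hY y hy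
  replace hy' := hfac Y' hY' y' hy'
  clear hwY hwY' hY hY' Y Y'
  wlog hle : y.length ≤ y'.length generalizing w w' x y z x' y' z'
  · obtain ⟨x₁, z₁, x₂, z₂, y₁, y₂, h₁, h₂, e₁, e₂, hl, hb⟩ :=
      this w' w hlen.symm x' y' z' hwy' hx' hz' x y z hwy hx hz hy' hy (by lia)
    exact ⟨x₂, z₂, x₁, z₁, y₂, y₁, h₂, h₁, e₂, e₁, hl.symm, by rwa [max_comm]⟩
  have hu : y'.take y.length ++ y'.drop y.length = y' := List.take_append_drop ..
  have hv : y'.take y.length ∈ L := hfac y' hy' _ (List.take_prefix ..).isInfix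
  have hvl : y.length = (y'.take y.length).length := by simp [hle]
  generalize y'.take y.length = v at *
  generalize y'.drop y.length = u at *
  subst hu
  have hσ := length_applyS_le_add (C := C) hM (y := y) (y' := v) fun a => by
    have := (abs_le.1 (hbal a y hy v hv hvl)).2
    rw [occ_singleton, occ_singleton] at this
    lia
  rw [applyS_append] at hwy'
  refine ⟨x, z, x', applyS σ u ++ z', y, v, hy, hv, hwy, by simpa using hwy', hvl, ?_⟩
  rw [hwy, hwy'] at hlen
  simp only [List.length_append] at hlen ⊢
  rw [add_mul]
  rcases Nat.eq_zero_or_pos M with h0 | h0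
  · simp only [h0, mul_zero] at *
    lia
  · generalize C * Fintype.card A * M = K at *
    lia
end
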